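/- A finite simple graph G on n vertices is strongly chordal if and only if there exists an ordering v_1, v_2, …, v_n of its vertices such that for each i, the vertex v_i is simple in the subgraph of G induced by {v_i, v_{i+1}, …, v_n}. -/

import Mathlib

/-- A cycle of length `n` in `G`, given as an injective map from `ZMod n`
whose consecutive images are adjacent. -/
def SimpleGraph.IsCycleEmb {V : Type*} (G : SimpleGraph V) {n : ℕ} (f : ZMod n → V) : Prop :=
  Function.Injective f ∧ ∀ i : ZMod n, G.Adj (f i) (f (i + 1))

/-- A chord of the cycle `f`: an edge of `G` joining two non-consecutive
vertices of the cycle. -/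
def SimpleGraph.IsChordOf {V : Type*} (G : SimpleGraph V) {n : ℕ} (f : ZMod n → V)
    (i j : ZMod n) : Prop :=
  G.Adj (f i) (f j) ∧ j ≠ i + 1 ∧ i ≠ j + 1

/-- A graph is chordal if every cycle of length at least 4 has a chord,
i.e. it has no chordless cycle of size 4 or more. -/
def SimpleGraph.Chordal {V : Type*} (G : SimpleGraph V) : Prop :=
  ∀ (n : ℕ), 4 ≤ n → ∀ f : ZMod n → V, G.IsCycleEmb f → ∃ i j, G.IsChordOf f i j

/-- A strong chord of the (even) cycle `f`: a chord joining two vertices whose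
distance apart along the cycle is odd. -/
def SimpleGraph.IsStrongChordOf {V : Type*} (G : SimpleGraph V) {n : ℕ} (f : ZMod n → V)
    (i j : ZMod n) : Prop :=
  G.IsChordOf f i j ∧ Odd (j - i).val

/-- A graph is strongly chordal if it is chordal and every even cycle of length
at least 6 has a strong chord. -/
def SimpleGraph.StronglyChordal {V : Type*} (G : SimpleGraph V) : Prop :=
  G.Chordal ∧ ∀ (n : ℕ), 6 ≤ n → Even n → ∀ f : ZMod n → V, G.IsCycleEmb f →
    ∃ i j, G.IsStrongChordOf f i j

/-- The closed neighborhood `N[v]` of a vertex `v`. -/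
def SimpleGraph.closedNbhd {V : Type*} (G : SimpleGraph V) (v : V) : Set V :=
  insert v (G.neighborSet v)

/-- A vertex is simplicial if its open neighborhood induces a clique. -/
def SimpleGraph.IsSimplicialVertex {V : Type*} (G : SimpleGraph V) (v : V) : Prop :=
  ∀ u w, G.Adj v u → G.Adj v w → u ≠ w → G.Adj u w

/-- A vertex is simple if the vertices in its closed neighborhood are pairwise
compatible, i.e. their closed neighborhoods are linearly ordered by inclusion. -/
def SimpleGraph.IsSimpleVertex {V : Type*} (G : SimpleGraph V) (v : V) : Prop :=
  ∀ u w, u ∈ G.closedNbhd v → w ∈ G.closedNbhd v →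
    G.closedNbhd u ⊆ G.closedNbhd w ∨ G.closedNbhd w ⊆ G.closedNbhd u

/-- A perfect elimination ordering: each `σ i` is simplicial in the subgraph of `G`
induced by the vertex set `{σ j : i ≤ j}`. -/
def SimpleGraph.IsPerfectElimOrdering {V : Type*} [Fintype V] (G : SimpleGraph V)
    (σ : Fin (Fintype.card V) ≃ V) : Prop :=
  ∀ i : Fin (Fintype.card V),
    (G.induce (σ '' {j | i ≤ j})).IsSimplicialVertex ⟨σ i, ⟨i, le_refl i, rfl⟩⟩

/-- A strong elimination ordering: for all `i < j` and `k < l`, if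
`σ k, σ l ∈ N[σ i]` and `σ k ∈ N[σ j]`, then `σ l ∈ N[σ j]`. -/
def SimpleGraph.IsStrongElimOrdering {V : Type*} [Fintype V] (G : SimpleGraph V)
    (σ : Fin (Fintype.card V) ≃ V) : Prop :=
  ∀ i j k l : Fin (Fintype.card V), i < j → k < l →
    σ k ∈ G.closedNbhd (σ i) → σ l ∈ G.closedNbhd (σ i) →
    σ k ∈ G.closedNbhd (σ j) → σ l ∈ G.closedNbhd (σ j)

/-- Closed adjacency. -/
def CA {V : Type*} (G : SimpleGraph V) (u v : V) : Prop := u = v ∨ G.Adj u v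

theorem CA.symm {V : Type*} {G : SimpleGraph V} {u v : V} (h : CA G u v) : CA G v u := by
  rcases h with h | h
  · exact Or.inl h.symm
  · exact Or.inr h.symm

theorem CA.refl {V : Type*} (G : SimpleGraph V) (u : V) : CA G u u := Or.inl rfl

theorem mem_closedNbhd_iff {V : Type*} (G : SimpleGraph V) (u v : V) :
    u ∈ G.closedNbhd v ↔ CA G v u := by
  unfold SimpleGraph.closedNbhd CA
  simp [eq_comm]

theorem zval_succ {n : ℕ} [NeZero n] (hn : 2 ≤ n) (i : ZMod n) :
    (i + 1).val = if i.val + 1 = n then 0 else i.val + 1 := by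
  have h1 : (1 : ZMod n).val = 1 := ZMod.val_one'' (by omega)
  have hi := ZMod.val_lt i
  rw [ZMod.val_add, h1]
  split_ifs with h
  · rw [h]; simp
  · exact Nat.mod_eq_of_lt (by omega)

theorem zval_succ_iff {n : ℕ} [NeZero n] (hn : 2 ≤ n) (i j : ZMod n) :
    j = i + 1 ↔ (j.val = i.val + 1 ∨ (j.val = 0 ∧ i.val + 1 = n)) := by
  rw [← (ZMod.val_injective n).eq_iff, zval_succ hn]
  have hi := ZMod.val_lt i
  have hj := ZMod.val_lt j
  split_ifs <;> omega

theorem cycle_of_nat {V : Type*} (G : SimpleGraph V) {n : ℕ} [NeZero n] (hn : 2 ≤ n) (g : ℕ → V)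
    (hinj : ∀ a b, a < b → b < n → g a ≠ g b)
    (hadj : ∀ a, a + 1 < n → G.Adj (g a) (g (a + 1)))
    (hend : G.Adj (g (n - 1)) (g 0)) :
    G.IsCycleEmb (fun z : ZMod n => g z.val) := by
  refine ⟨?_, ?_⟩
  · intro x y hxy
    apply ZMod.val_injective n
    have hx := ZMod.val_lt x
    have hy := ZMod.val_lt y
    rcases lt_trichotomy x.val y.val with h | h | h
    · exact absurd hxy (hinj _ _ h hy)
    · exact h
    · exact absurd hxy.symm (hinj _ _ h hx)
  · intro i
    have hi := ZMod.val_lt i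
    show G.Adj (g i.val) (g (i + 1).val)
    rw [zval_succ hn]
    split_ifs with h
    · have : i.val = n - 1 := by omega
      rw [this]; exact hend
    · exact hadj _ (by omega)

theorem chord_nat {V : Type*} (G : SimpleGraph V) {n : ℕ} [NeZero n] (hn : 2 ≤ n) (g : ℕ → V)
    (i j : ZMod n) (h : G.IsChordOf (fun z : ZMod n => g z.val) i j) :
    ∃ a b, a < b ∧ b < n ∧ G.Adj (g a) (g b) ∧ b ≠ a + 1 ∧ ¬ (a = 0 ∧ b + 1 = n) ∧
      (Even n → Odd (j - i).val → Odd (b - a)) := by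
  obtain ⟨h1, h2, h3⟩ := h
  rw [Ne, zval_succ_iff hn] at h2 h3
  have hi := ZMod.val_lt i
  have hj := ZMod.val_lt j
  have hne : i.val ≠ j.val := by
    intro h; simp only [h] at h1; exact G.loopless.irrefl _ h1
  rcases lt_or_gt_of_ne hne with h | h
  · refine ⟨i.val, j.val, h, hj, h1, by omega, by omega, ?_⟩
    intro _ ho
    rwa [ZMod.val_sub h.le] at ho
  · refine ⟨j.val, i.val, h, hi, h1.symm, by omega, by omega, ?_⟩
    intro he ho
    have h5 : (i - j).val = i.val - j.val := ZMod.val_sub h.le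
    have h6 : (j - i).val = n - (i.val - j.val) := by
      have : NeZero (i - j) := ⟨by
        intro h7; rw [h7] at h5; simp at h5; omega⟩
      rw [← neg_sub, ZMod.val_neg_of_ne_zero, h5]
    rw [h6] at ho
    rw [Nat.odd_iff] at *
    rw [Nat.even_iff] at he
    omega

theorem chordal_nat {V : Type*} (G : SimpleGraph V) (hG : G.Chordal) {n : ℕ} (hn : 4 ≤ n)
    (g : ℕ → V)
    (hinj : ∀ a b, a < b → b < n → g a ≠ g b)
    (hadj : ∀ a, a + 1 < n → G.Adj (g a) (g (a + 1)))
    (hend : G.Adj (g (n - 1)) (g 0)) :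
    ∃ a b, a < b ∧ b < n ∧ G.Adj (g a) (g b) ∧ b ≠ a + 1 ∧ ¬ (a = 0 ∧ b + 1 = n) := by
  haveI : NeZero n := ⟨by omega⟩
  obtain ⟨i, j, h⟩ := hG n hn _ (cycle_of_nat G (by omega) g hinj hadj hend)
  obtain ⟨a, b, h1, h2, h3, h4, h5, -⟩ := chord_nat G (by omega) g i j h
  exact ⟨a, b, h1, h2, h3, h4, h5⟩

theorem strong_nat {V : Type*} (G : SimpleGraph V) (hG : G.StronglyChordal) {n : ℕ} (hn : 6 ≤ n)
    (he : Even n) (g : ℕ → V)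
    (hinj : ∀ a b, a < b → b < n → g a ≠ g b)
    (hadj : ∀ a, a + 1 < n → G.Adj (g a) (g (a + 1)))
    (hend : G.Adj (g (n - 1)) (g 0)) :
    ∃ a b, a < b ∧ b < n ∧ G.Adj (g a) (g b) ∧ b ≠ a + 1 ∧ ¬ (a = 0 ∧ b + 1 = n) ∧
      Odd (b - a) := by
  haveI : NeZero n := ⟨by omega⟩
  obtain ⟨i, j, h, ho⟩ := hG.2 n hn he _ (cycle_of_nat G (by omega) g hinj hadj hend)
  obtain ⟨a, b, h1, h2, h3, h4, h5, h6⟩ := chord_nat G (by omega) g i j h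
  exact ⟨a, b, h1, h2, h3, h4, h5, h6 he ho⟩

/-- walk from a to b whose inner vertices are outside the closed neighborhood of v -/
def AvoidWalk {V : Type*} (G : SimpleGraph V) (v a b : V) (L : ℕ) (w : ℕ → V) : Prop :=
  w 0 = a ∧ w L = b ∧ (∀ k, k < L → CA G (w k) (w (k + 1))) ∧
    ∀ k, 0 < k → k < L → ¬ CA G v (w k)

theorem shortcut {V : Type*} (G : SimpleGraph V) (v a b : V) (L : ℕ) (w : ℕ → V)
    (hw : AvoidWalk G v a b L w) (i d : ℕ) (hd : i + d + 1 ≤ L)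
    (h : CA G (w i) (w (i + d + 1))) :
    AvoidWalk G v a b (L - d) (fun k => if k ≤ i then w k else w (k + d)) := by
  obtain ⟨h0, hL, h1, h2⟩ := hw
  refine ⟨by simpa using h0, ?_, ?_, ?_⟩
  · have : ¬ (L - d ≤ i) := by omega
    simp only [this, if_false]
    rw [Nat.sub_add_cancel (by omega)]; exact hL
  · intro k hk
    by_cases hki : k < i
    · simp only [show k ≤ i by omega, show k + 1 ≤ i by omega, if_true]
      exact h1 k (by omega)
    · by_cases hki2 : k = i
      · subst hki2
        simp only [le_refl, if_true, show ¬ (k + 1 ≤ k) by omega, if_false]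
        rwa [show k + 1 + d = k + d + 1 by omega]
      · simp only [show ¬ (k ≤ i) by omega, show ¬ (k + 1 ≤ i) by omega, if_false]
        rw [show k + 1 + d = k + d + 1 by omega]
        exact h1 _ (by omega)
  · intro k hk0 hk
    by_cases hki : k ≤ i
    · simp only [hki, if_true]; exact h2 k hk0 (by omega)
    · simp only [hki, if_false]; exact h2 _ (by omega) (by omega)

theorem shortcut_eq {V : Type*} (G : SimpleGraph V) (v a b : V) (L : ℕ) (w : ℕ → V)
    (hw : AvoidWalk G v a b L w) (i : ℕ) (hd : i + 1 ≤ L)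
    (h : w i = w (i + 1)) (hab : a ≠ b) : ∃ L' < L, ∃ w', AvoidWalk G v a b L' w' := by
  by_cases hL2 : i + 1 = L
  · obtain ⟨h0, hL, h1, h2⟩ := hw
    refine ⟨i, by omega, w, h0, ?_, fun k hk => h1 k (by omega),
      fun k hk hk' => h2 k hk (by omega)⟩
    rw [h, hL2, hL]
  · have := shortcut G v a b L w hw i 1 (by omega) (by
      rw [h]; exact hw.2.2.1 (i + 1) (by omega))
    exact ⟨L - 1, by omega, _, this⟩

theorem chordal_avoid {V : Type*} (G : SimpleGraph V) (hG : G.Chordal) (v a b : V)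
    (ha : G.Adj v a) (hb : G.Adj v b) (hw : ∃ L w, AvoidWalk G v a b L w) : CA G a b := by
  classical
  by_contra hab
  have hne : a ≠ b := fun h => hab (Or.inl h)
  have hmin := fun {k : ℕ} => Nat.find_min hw (m := k)
  obtain ⟨w, hw'⟩ := Nat.find_spec hw
  set L := Nat.find hw with hLdef
  have hmin' : ∀ L' < L, ∀ w', ¬ AvoidWalk G v a b L' w' := fun L' h w' h' => hmin h ⟨w', h'⟩
  have hnear : ∀ i j, i < j → j ≤ L → CA G (w i) (w j) → j = i + 1 := by
    intro i j hij hj h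
    by_contra hne
    have := shortcut G v a b L w hw' i (j - i - 1) (by omega) (by
      rwa [show i + (j - i - 1) + 1 = j by omega])
    exact hmin' _ (by omega) _ this
  have hinj : ∀ i j, i < j → j ≤ L → w i ≠ w j := by
    intro i j hij hj h
    have h2 := hnear i j hij hj (Or.inl h)
    subst h2
    obtain ⟨L', h3, w', h4⟩ := shortcut_eq G v a b L w hw' i hj h hne
    exact hmin' _ h3 _ h4
  obtain ⟨h0, hL, h1, h2⟩ := hw'
  have hL2 : 2 ≤ L := by
    by_contra hlt
    have : L = 0 ∨ L = 1 := by omega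
    rcases this with h | h
    · rw [h] at hL; exact hne (h0.symm.trans hL)
    · apply hab; rw [← h0, ← hL, h]; exact h1 0 (by omega)
  have hv : ∀ k, k ≤ L → w k ≠ v := by
    intro k hk h
    by_cases hk0 : k = 0
    · subst hk0; rw [h0] at h; subst h; exact G.loopless.irrefl _ ha
    by_cases hkL : k = L
    · subst hkL; rw [hL] at h; subst h; exact G.loopless.irrefl _ hb
    · exact h2 k (by omega) (by omega) (Or.inl h.symm)
  obtain ⟨x, y, hxy, hy, hA, hn1, hn2⟩ := chordal_nat G hG (n := L + 2) (by omega)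
    (fun k => if k ≤ L then w k else v)
    (by
      intro x y hxy hy
      by_cases hyL : y ≤ L
      · simp only [hyL, show x ≤ L by omega, if_true]; exact hinj _ _ hxy hyL
      · simp only [hyL, show x ≤ L by omega, if_true, if_false]; exact hv _ (by omega))
    (by
      intro x hx
      by_cases hyL : x + 1 ≤ L
      · simp only [hyL, show x ≤ L by omega, if_true]
        exact (h1 x (by omega)).resolve_left (hinj _ _ (by omega) hyL)
      · simp only [hyL, show x ≤ L by omega, if_true, if_false]
        rw [show x = L by omega, hL]; exact hb.symm)
    (by
      simp only [show ¬ (L + 2 - 1 ≤ L) by omega, if_false, Nat.zero_le, if_true, h0]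
      exact ha)
  by_cases hyL : y ≤ L
  · simp only [hyL, show x ≤ L by omega, if_true] at hA
    exact hn1 (hnear _ _ hxy hyL (Or.inr hA))
  · simp only [hyL, show x ≤ L by omega, if_true, if_false] at hA
    exact h2 x (by omega) (by omega) (Or.inr hA.symm)

/-- Special cycle in the closed neighborhood matrix (indices in ℤ, periodic). -/
theorem no_special {V : Type*} (G : SimpleGraph V) (hG : G.StronglyChordal) (m : ℕ) (hm : 3 ≤ m)
    (q : ℕ → V)
    (h : ∀ a b, a < b → b < 2 * m → (b - a) % 2 = 1 →
      (CA G (q a) (q b) ↔ (b = a + 1 ∨ (a = 0 ∧ b + 1 = 2 * m)))) : False := by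
  have hs : ∀ a b, a < 2 * m → b < 2 * m → (a + b) % 2 = 1 →
      (CA G (q a) (q b) ↔ (b = a + 1 ∨ a = b + 1 ∨ (a = 0 ∧ b + 1 = 2 * m) ∨
        (b = 0 ∧ a + 1 = 2 * m))) := by
    intro a b ha hb hp
    rcases lt_trichotomy a b with hab | hab | hab
    · rw [h a b hab hb (by omega)]; omega
    · omega
    · rw [show CA G (q a) (q b) ↔ CA G (q b) (q a) from ⟨CA.symm, CA.symm⟩,
        h b a hab ha (by omega)]; omega
  have key : ∀ s, s < 2 * m → q s ≠ q ((s + 1) % (2 * m)) := by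
    intro s hs1 heq
    have hmod : ∀ k, k < 2 * m → (s + k) % (2 * m) = if s + k < 2 * m then s + k
        else s + k - 2 * m := by
      intro k hk
      split_ifs with h3
      · exact Nat.mod_eq_of_lt h3
      · rw [Nat.mod_eq_sub_mod (by omega)]; exact Nat.mod_eq_of_lt (by omega)
    have hr : ∀ a b, a < 2 * m → b < 2 * m → (a + b) % 2 = 1 →
      (CA G (q ((s + a) % (2 * m))) (q ((s + b) % (2 * m))) ↔
        (b = a + 1 ∨ a = b + 1 ∨ (a = 0 ∧ b + 1 = 2 * m) ∨
        (b = 0 ∧ a + 1 = 2 * m))) := by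
      intro a b ha hb hp
      rw [hmod a ha, hmod b hb]
      rw [hs _ _ (by split_ifs <;> omega) (by split_ifs <;> omega) (by split_ifs <;> omega)]
      split_ifs <;> omega
    obtain ⟨r, hrdef⟩ : ∃ r : ℕ → V, ∀ k, r k = q ((s + k) % (2 * m)) := ⟨_, fun _ => rfl⟩
    simp only [← hrdef] at hr heq
    have hr0 : r 0 = r 1 := by
      rw [← heq, hrdef, Nat.add_zero, Nat.mod_eq_of_lt hs1]
    have hv : ∀ k, 2 ≤ k → k < 2 * m → (CA G (r 0) (r k) ↔ (k = 2 ∨ k + 1 = 2 * m)) := by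
      intro k hk hk2
      rcases Nat.even_or_odd k with hp | hp
      · rw [Nat.even_iff] at hp
        rw [hr0, hr 1 k (by omega) hk2 (by omega)]; omega
      · rw [Nat.odd_iff] at hp
        rw [hr 0 k (by omega) hk2 (by omega)]; omega
    have hn2 : ¬ CA G (r 2) (r (2 * m - 1)) := by
      rw [hr _ _ (by omega) (by omega) (by omega)]; omega
    have e1 : CA G (r 0) (r 2) := (hv 2 (by omega) (by omega)).2 (by omega)
    have e2 : CA G (r 0) (r (2 * m - 1)) := (hv _ (by omega) (by omega)).2 (by omega)
    have f1 : G.Adj (r 0) (r 2) := by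
      refine e1.resolve_left (fun h4 => hn2 ?_)
      rwa [← h4]
    have f2 : G.Adj (r 0) (r (2 * m - 1)) := by
      refine e2.resolve_left (fun h4 => hn2 ?_)
      rw [← h4]; exact e1.symm
    apply hn2
    refine chordal_avoid G hG.1 (r 0) _ _ f1 f2 ⟨2 * m - 3, fun k => r (k + 2), ?_, ?_, ?_, ?_⟩
    · rfl
    · show r (2 * m - 3 + 2) = _
      congr 1; omega
    · intro k hk
      exact (hr _ _ (by omega) (by omega) (by omega)).2 (by omega)
    · intro k hk0 hk
      show ¬ CA G (r 0) (r (k + 2))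
      rw [hv _ (by omega) (by omega)]; omega
  have key1 : ∀ s, s + 1 < 2 * m → q s ≠ q (s + 1) := by
    intro s hs1
    have := key s (by omega)
    rwa [Nat.mod_eq_of_lt hs1] at this
  have key2 : q (2 * m - 1) ≠ q 0 := by
    have := key (2 * m - 1) (by omega)
    rwa [Nat.sub_add_cancel (by omega), Nat.mod_self] at this
  obtain ⟨a, b, hab, hb, hA, hn1, hn2, ho⟩ := strong_nat G hG (n := 2 * m) (by omega)
    (even_two_mul m) q
    (by
      intro a b hab hb heq
      rcases Nat.mod_two_eq_zero_or_one (b - a) with hp | hp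
      · -- find c adjacent to a not to b
        have : ∀ c, c < 2 * m → (a + c) % 2 = 1 →
            (c = a + 1 ∨ a = c + 1 ∨ (a = 0 ∧ c + 1 = 2 * m) ∨ (c = 0 ∧ a + 1 = 2 * m)) →
            (c = b + 1 ∨ b = c + 1 ∨ (b = 0 ∧ c + 1 = 2 * m) ∨ (c = 0 ∧ b + 1 = 2 * m)) := by
          intro c hc hpc h1
          rw [← hs a c (by omega) hc hpc, heq, hs b c hb hc (by omega)] at h1
          exact h1
        have t1 := this (a + 1) (by omega) (by omega) (by omega)
        by_cases ha0 : a = 0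
        · have t2 := this (2 * m - 1) (by omega) (by omega) (by omega)
          omega
        · have t2 := this (a - 1) (by omega) (by omega) (by omega)
          omega
      · have := (h a b hab hb hp).1 (Or.inl heq)
        rcases this with h1 | ⟨h1, h2⟩
        · subst h1; exact key1 _ hb heq
        · subst h1; apply key2; rw [heq]; congr 1; omega)
    (by
      intro a ha
      exact ((h a (a + 1) (by omega) ha (by omega)).2 (by omega)).resolve_left (key1 a ha))
    (by
      have := (h 0 (2 * m - 1) (by omega) (by omega) (by omega)).2 (by omega)
      exact this.symm.resolve_left key2)
  rw [Nat.odd_iff] at ho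
  have := (h a b hab hb ho).1 (Or.inr hA)
  omega

/-- Doubly lexical condition for rows. -/
def RowLex {V : Type*} (A : V → V → Prop) (r c : V → ℕ) : Prop :=
  ∀ u v j, r u < r v → A u j → ¬ A v j →
    ∃ j', c j < c j' ∧ ¬ A u j' ∧ A v j' ∧ ∀ k, c j' < c k → (A u k ↔ A v k)

theorem sum_pow_lt {V : Type*} [Fintype V] (c : V → ℕ) (hc : Function.Injective c)
    (P Q : V → Prop) [DecidablePred P] [DecidablePred Q] (j : V) (hP : P j) (hQ : ¬ Q j)
    (h : ∀ k, c j < c k → (P k ↔ Q k)) :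
    ∑ y, (if Q y then 2 ^ c y else 0) < ∑ y, (if P y then 2 ^ c y else 0) := by
  classical
  have h1 : ∑ y ∈ Finset.univ.filter (fun y => c y < c j), 2 ^ c y < 2 ^ c j := by
    have := Nat.geomSum_lt (m := 2) (n := c j)
      (s := (Finset.univ.filter (fun y => c y < c j)).image c) le_rfl (by simp)
    rwa [Finset.sum_image (fun x _ y _ h => hc h)] at this
  have h2 : ∀ y, (if Q y then 2 ^ c y else 0) + (if y = j then 2 ^ c j else 0) ≤
      (if P y then 2 ^ c y else 0) + (if c y < c j then 2 ^ c y else 0) := by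
    intro y
    rcases lt_trichotomy (c y) (c j) with hy | hy | hy
    · have : y ≠ j := by rintro rfl; omega
      simp only [this, hy, if_true, if_false]
      generalize 2 ^ c y = t
      split_ifs <;> omega
    · have := hc hy
      subst this
      simp [hP, hQ]
    · have h3 : y ≠ j := by rintro rfl; omega
      have h4 : ¬ c y < c j := by omega
      simp [h3, h4, h y hy]
  have h3 := Finset.sum_le_sum (fun y (_ : y ∈ Finset.univ) => h2 y)
  rw [Finset.sum_add_distrib, Finset.sum_add_distrib, Finset.sum_ite_eq' Finset.univ j,
    if_pos (Finset.mem_univ j), ← Finset.sum_filter (fun y => c y < c j)] at h3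
  omega

/-- weight -/
noncomputable def wt {V : Type*} [Fintype V] (A : V → V → Prop) (r c : V → ℕ) : ℕ := by
  classical
  exact ∑ x, 2 ^ r x * ∑ y, (if A x y then 2 ^ c y else 0)

theorem wt_symm {V : Type*} [Fintype V] (A : V → V → Prop) (hA : ∀ x y, A x y → A y x)
    (r c : V → ℕ) : wt A r c = wt A c r := by
  classical
  unfold wt
  simp only [Finset.mul_sum]
  rw [Finset.sum_comm]
  refine Finset.sum_congr rfl fun y _ => Finset.sum_congr rfl fun x _ => ?_
  have : A x y ↔ A y x := ⟨hA _ _, hA _ _⟩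
  simp only [this]
  split_ifs
  · ring
  · simp

theorem rowLex_of_max {V : Type*} [Fintype V] (A : V → V → Prop) (r c : V → ℕ)
    (hc : Function.Injective c)
    (hmax : ∀ π : Equiv.Perm V, wt A (r ∘ π) c ≤ wt A r c) : RowLex A r c := by
  classical
  intro u v j huv hu hv
  obtain ⟨j', hj', hjmax⟩ := Finset.exists_max_image
    (Finset.univ.filter (fun k => ¬ (A u k ↔ A v k))) c ⟨j, by simp [hu, hv]⟩
  have hag : ∀ k, c j' < c k → (A u k ↔ A v k) := by
    intro k hk
    by_contra hne
    have := hjmax k (by simpa using hne)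
    omega
  have hjj : c j ≤ c j' := hjmax j (by simp [hu, hv])
  have hd : ¬ (A u j' ↔ A v j') := by simpa using hj'
  by_cases hu' : A u j'
  · exfalso
    have hv' : ¬ A v j' := fun h => hd ⟨fun _ => h, fun _ => hu'⟩
    have hlt := sum_pow_lt c hc (A u) (A v) j' hu' hv' hag
    have hne : u ≠ v := by rintro rfl; omega
    have hm := hmax (Equiv.swap u v)
    unfold wt at hm
    obtain ⟨B, hB⟩ : ∃ B : V → ℕ, ∀ x, B x = ∑ y, (if A x y then 2 ^ c y else 0) :=
      ⟨_, fun _ => rfl⟩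
    simp only [← hB] at hlt hm
    have hsplit : ∀ F : V → ℕ, ∑ x, F x =
        F u + (F v + ∑ x ∈ (Finset.univ.erase u).erase v, F x) := by
      intro F
      rw [Finset.add_sum_erase _ _ (by simp [hne.symm]), Finset.add_sum_erase _ _ (by simp)]
    rw [hsplit, hsplit (fun x => 2 ^ r x * B x)] at hm
    have hrest : ∑ x ∈ (Finset.univ.erase u).erase v, 2 ^ (r ∘ (Equiv.swap u v)) x * B x =
        ∑ x ∈ (Finset.univ.erase u).erase v, 2 ^ r x * B x := by
      refine Finset.sum_congr rfl fun x hx => ?_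
      simp only [Finset.mem_erase, Finset.mem_univ, and_true] at hx
      rw [Function.comp_apply, Equiv.swap_apply_of_ne_of_ne hx.2 hx.1]
    rw [hrest] at hm
    simp only [Function.comp_apply, Equiv.swap_apply_left, Equiv.swap_apply_right] at hm
    have hpow : 2 ^ r u < 2 ^ r v := Nat.pow_lt_pow_right (by norm_num) huv
    nlinarith
  · have hv' : A v j' := by
      by_contra h
      exact hd ⟨fun h' => absurd h' hu', fun h' => absurd h' h⟩
    refine ⟨j', lt_of_le_of_ne hjj ?_, hu', hv', hag⟩
    intro h
    have := hc h
    subst this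
    exact hu' hu

theorem exists_doublyLex {V : Type*} [Fintype V] (A : V → V → Prop)
    (hA : ∀ x y, A x y → A y x) :
    ∃ r c : V → ℕ, Function.Injective r ∧ Function.Injective c ∧ RowLex A r c ∧ RowLex A c r := by
  classical
  let e : V → ℕ := fun x => (Fintype.equivFin V x : ℕ)
  have he : Function.Injective e := fun x y h => (Fintype.equivFin V).injective (Fin.ext h)
  obtain ⟨⟨p, s⟩, -, hmax⟩ := Finset.exists_max_image
    (Finset.univ : Finset (Equiv.Perm V × Equiv.Perm V))
    (fun ps => wt A (e ∘ ps.1) (e ∘ ps.2)) ⟨(1, 1), by simp⟩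
  have hr : Function.Injective (e ∘ p) := he.comp p.injective
  have hc : Function.Injective (e ∘ s) := he.comp s.injective
  refine ⟨e ∘ p, e ∘ s, hr, hc, ?_, ?_⟩
  · refine rowLex_of_max A _ _ hc fun π => ?_
    exact hmax (π.trans p, s) (Finset.mem_univ _)
  · refine rowLex_of_max A _ _ hr fun π => ?_
    rw [wt_symm A hA, wt_symm A hA (e ∘ s)]
    exact hmax (p, π.trans s) (Finset.mem_univ _)

/-- The state in the construction of the special cycle. -/
structure LexState {V : Type*} (A : V → V → Prop) (r c : V → ℕ) (m : ℤ) (p : ℤ → V) : Prop where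
  two_le : 2 ≤ m
  adj : ∀ s, 1 - m ≤ s → s < m → A (p s) (p (s + 1))
  nonadj : ∀ s t, 1 - m ≤ s → s < t → t ≤ m → (t - s) % 2 = 1 → t ≠ s + 1 →
    ¬ (s = 1 - m ∧ t = m) → ¬ A (p s) (p t)
  agree1 : ∀ v, r (p (1 - m)) < r v → ∀ s, 1 - m ≤ s → s < m → (m - s) % 2 = 0 →
    (A v (p s) ↔ A v (p (2 - m)))
  agree2 : ∀ v, c (p m) < c v → ∀ s, 1 - m < s → s ≤ m → (m - s) % 2 = 1 →
    (A v (p s) ↔ A v (p (m - 1)))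
  ord1 : c (p (2 - m)) < c (p m)
  ord2 : r (p (m - 1)) < r (p (1 - m))

theorem LexState.step {V : Type*} {A : V → V → Prop} (hA : ∀ x y, A x y → A y x)
    {r c : V → ℕ} (h1 : RowLex A r c) (h2 : RowLex A c r) {m : ℤ} {p : ℤ → V}
    (S : LexState A r c m p) (hend : ¬ A (p (1 - m)) (p m)) :
    ∃ p', LexState A c r (m + 1) p' ∧
      r (p (1 - m)) + c (p m) < c (p' (1 - (m + 1))) + r (p' (m + 1)) := by
  have hm := S.two_le
  obtain ⟨x, hx1, hx2, hx3, hx4⟩ := h2 (p (2 - m)) (p m) (p (1 - m)) S.ord1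
    (hA _ _ (by
      have := S.adj (1 - m) (by omega) (by omega)
      rwa [show 1 - m + 1 = 2 - m by omega] at this)) (fun h => hend (hA _ _ h))
  obtain ⟨y, hy1, hy2, hy3, hy4⟩ := h1 (p (m - 1)) (p (1 - m)) (p m) S.ord2
    (by
      have := S.adj (m - 1) (by omega) (by omega)
      rwa [show m - 1 + 1 = m by omega] at this) hend
  have hAs : ∀ a b, A a b ↔ A b a := fun a b => ⟨hA _ _, hA _ _⟩
  obtain ⟨p', hp'⟩ : ∃ p' : ℤ → V, ∀ s, p' s = if s = m + 1 then x else
    if s = -m then y else p s := ⟨_, fun _ => rfl⟩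
  have pm1 : p' (m + 1) = x := by simp [hp']
  have pmm : p' (-m) = y := by
    rw [hp', if_neg (by omega), if_pos rfl]
  have pold : ∀ s, 1 - m ≤ s → s ≤ m → p' s = p s := by
    intro s hs hs'
    rw [hp', if_neg (by omega), if_neg (by omega)]
  have e1 : 1 - (m + 1) = -m := by omega
  refine ⟨p', ⟨by omega, ?_, ?_, ?_, ?_, ?_, ?_⟩, ?_⟩
  · intro s hs hs'
    by_cases c1 : s = m
    · subst c1
      rw [pm1, pold _ (by omega) (by omega)]; exact hA _ _ ((hAs _ _).1 hx3)
    by_cases c2 : s = -m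
    · subst c2
      rw [pmm, pold _ (by omega) (by omega), show -m + 1 = 1 - m by omega]; exact hA _ _ hy3
    · rw [pold _ (by omega) (by omega), pold _ (by omega) (by omega)]
      exact S.adj s (by omega) (by omega)
  · intro s t hs hst ht hpar hne hnend
    by_cases c1 : t = m + 1
    · subst c1
      rw [pm1, pold _ (by omega) (by omega), hAs]
      rw [S.agree1 x hx1 s (by omega) (by omega) (by omega), hAs]
      exact fun h => hx2 h
    by_cases c2 : s = -m
    · subst c2
      rw [pmm, pold _ (by omega) (by omega)]
      rw [S.agree2 y hy1 t (by omega) (by omega) (by omega), hAs]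
      exact hy2
    · rw [pold _ (by omega) (by omega), pold _ (by omega) (by omega)]
      by_cases c3 : s = 1 - m ∧ t = m
      · rw [c3.1, c3.2]; exact hend
      · exact S.nonadj s t (by omega) hst (by omega) hpar hne c3
  · intro v hv s hs hs' hpar
    rw [e1, pmm] at hv
    rw [pold s (by omega) (by omega), pold _ (by omega) (by omega),
      show 2 - (m + 1) = 1 - m by omega]
    by_cases c1 : s = 1 - m
    · rw [c1]
    · rw [S.agree2 v (by omega) s (by omega) (by omega) (by omega), hAs v, hAs v]
      exact hy4 v hv
  · intro v hv s hs hs' hpar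
    rw [pm1] at hv
    rw [pold s (by omega) (by omega), pold _ (by omega) (by omega),
      show m + 1 - 1 = m by omega]
    by_cases c1 : s = m
    · rw [c1]
    · rw [S.agree1 v (by omega) s (by omega) (by omega) (by omega), hAs v, hAs v]
      exact hx4 v hv
  · rw [pm1, pold _ (by omega) (by omega), show 2 - (m + 1) = 1 - m by omega]; exact hx1
  · rw [e1, pmm, pold _ (by omega) (by omega), show m + 1 - 1 = m by omega]; exact hy1
  · rw [e1, pmm, pm1]; omega

theorem no_state {V : Type*} [Fintype V] (G : SimpleGraph V) (hG : G.StronglyChordal) (N : ℕ) :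
    ∀ (d : ℕ) (r c : V → ℕ) (_ : ∀ v, r v ≤ N) (_ : ∀ v, c v ≤ N)
      (_ : RowLex (CA G) r c) (_ : RowLex (CA G) c r) (m : ℤ) (p : ℤ → V)
      (_ : LexState (CA G) r c m p) (_ : m = 2 → ¬ CA G (p (1 - m)) (p m))
      (_ : 2 * N ≤ r (p (1 - m)) + c (p m) + d), False := by
  intro d
  induction d with
  | zero =>
    intro r c hr hc h1 h2 m p S h0 hd
    have hm := S.two_le
    by_cases hend : CA G (p (1 - m)) (p m)
    · have hm3 : 3 ≤ m := by
        by_contra h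
        exact h0 (by omega) hend
      obtain ⟨k, rfl⟩ : ∃ k : ℕ, m = k := ⟨m.toNat, by omega⟩
      refine no_special G hG k (by omega) (fun a => p (a + 1 - k)) ?_
      intro a b hab hb hpar
      show CA G (p (a + 1 - k)) (p (b + 1 - k)) ↔ _
      constructor
      · intro h
        by_contra hcon
        exact S.nonadj _ _ (by omega) (by omega) (by omega) (by omega) (by omega) (by omega) h
      · rintro (h | ⟨h, h'⟩)
        · subst h
          have := S.adj (a + 1 - k) (by omega) (by omega)
          rw [show ((a + 1 : ℕ) : ℤ) + 1 - k = a + 1 - k + 1 by push_cast; ring]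
          exact this
        · rw [show (a : ℤ) + 1 - k = 1 - k by omega, show (b : ℤ) + 1 - k = k by omega]
          exact hend
    · obtain ⟨p', S', hlt⟩ := S.step (fun _ _ => CA.symm) h1 h2 hend
      have := hc (p' (1 - (m + 1)))
      have := hr (p' (m + 1))
      omega
  | succ d ih =>
    intro r c hr hc h1 h2 m p S h0 hd
    have hm := S.two_le
    by_cases hend : CA G (p (1 - m)) (p m)
    · have hm3 : 3 ≤ m := by
        by_contra h
        exact h0 (by omega) hend
      obtain ⟨k, rfl⟩ : ∃ k : ℕ, m = k := ⟨m.toNat, by omega⟩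
      refine no_special G hG k (by omega) (fun a => p (a + 1 - k)) ?_
      intro a b hab hb hpar
      show CA G (p (a + 1 - k)) (p (b + 1 - k)) ↔ _
      constructor
      · intro h
        by_contra hcon
        exact S.nonadj _ _ (by omega) (by omega) (by omega) (by omega) (by omega) (by omega) h
      · rintro (h | ⟨h, h'⟩)
        · subst h
          have := S.adj (a + 1 - k) (by omega) (by omega)
          rw [show ((a + 1 : ℕ) : ℤ) + 1 - k = a + 1 - k + 1 by push_cast; ring]
          exact this
        · rw [show (a : ℤ) + 1 - k = 1 - k by omega, show (b : ℤ) + 1 - k = k by omega]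
          exact hend
    · obtain ⟨p', S', hlt⟩ := S.step (fun _ _ => CA.symm) h1 h2 hend
      exact ih c r hc hr h2 h1 (m + 1) p' S' (by omega) (by omega)

theorem exists_simple {V : Type*} [Fintype V] [Nonempty V] (G : SimpleGraph V)
    (hG : G.StronglyChordal) : ∃ v, G.IsSimpleVertex v := by
  classical
  obtain ⟨r, c, hr, hc, h1, h2⟩ := exists_doublyLex (CA G) (fun _ _ => CA.symm)
  obtain ⟨j, -, hj⟩ := Finset.exists_min_image (Finset.univ : Finset V) c Finset.univ_nonempty
  have key : ∀ u w, CA G j u → CA G j w → r u < r w → ∀ x, CA G u x → CA G w x := by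
    intro u w hu hw huw x hx
    by_contra hwx
    have hjx : c j < c x := by
      refine lt_of_le_of_ne (hj x (Finset.mem_univ _)) fun h => ?_
      have := hc h
      subst this
      exact hwx hw.symm
    obtain ⟨p, q0, q1, q2, qm⟩ : ∃ p : ℤ → V, p 0 = u ∧ p 1 = j ∧ p 2 = w ∧ p (-1) = x :=
      ⟨fun s => if s = 0 then u else if s = 1 then j else if s = 2 then w else x,
        by simp, by simp, by simp, by simp⟩
    let N := Finset.univ.sup r + Finset.univ.sup c
    have hrN : ∀ v, r v ≤ N := fun v =>
      (Finset.le_sup (f := r) (Finset.mem_univ v)).trans (Nat.le_add_right _ _)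
    have hcN : ∀ v, c v ≤ N := fun v =>
      (Finset.le_sup (f := c) (Finset.mem_univ v)).trans (Nat.le_add_left _ _)
    refine no_state G hG N (2 * N) c r hcN hrN h2 h1 2 p
      ⟨le_rfl, ?_, ?_, ?_, ?_, ?_, ?_⟩ ?_ (by omega)
    · intro s hs hs'
      have : s = -1 ∨ s = 0 ∨ s = 1 := by omega
      rcases this with rfl | rfl | rfl
      · norm_num [qm, q0]; exact hx.symm
      · norm_num [q1, q0]; exact hu.symm
      · norm_num [q1, q2]; exact hw
    · intro s t hs hst ht hpar hne hnn
      omega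
    · intro v hv s hs hs' hpar
      have : s = 0 := by omega
      subst this; norm_num
    · intro v hv s hs hs' hpar
      have : s = 1 := by omega
      subst this; norm_num
    · norm_num [q0, q2]; exact huw
    · norm_num [q1, qm]; exact hjx
    · intro _
      norm_num [qm, q2]
      exact fun h => hwx h.symm
  refine ⟨j, fun u w hu hw => ?_⟩
  rw [mem_closedNbhd_iff] at hu hw
  rcases lt_trichotomy (r u) (r w) with h | h | h
  · left; intro x hx
    rw [mem_closedNbhd_iff] at hx ⊢
    exact key u w hu hw h x hx
  · left; rw [hr h]
  · right; intro x hx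
    rw [mem_closedNbhd_iff] at hx ⊢
    exact key w u hw hu h x hx

theorem StronglyChordal_induce {V : Type*} (G : SimpleGraph V) (hG : G.StronglyChordal)
    (s : Set V) : (G.induce s).StronglyChordal := by
  have hcyc : ∀ {n : ℕ} (f : ZMod n → s), (G.induce s).IsCycleEmb f →
      G.IsCycleEmb (fun i => (f i : V)) := by
    intro n f hf
    exact ⟨fun x y h => hf.1 (Subtype.ext h), fun i => hf.2 i⟩
  refine ⟨fun n hn f hf => ?_, fun n hn he f hf => ?_⟩
  · obtain ⟨i, j, h⟩ := hG.1 n hn _ (hcyc f hf)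
    exact ⟨i, j, h⟩
  · obtain ⟨i, j, h⟩ := hG.2 n hn he _ (hcyc f hf)
    exact ⟨i, j, h⟩

/-- v is simple in the subgraph induced by s. -/
def SimpleIn {V : Type*} (G : SimpleGraph V) (s : Set V) (v : V) : Prop :=
  ∀ u ∈ s, ∀ w ∈ s, CA G v u → CA G v w →
    (∀ x ∈ s, CA G u x → CA G w x) ∨ (∀ x ∈ s, CA G w x → CA G u x)

theorem simpleIn_iff {V : Type*} (G : SimpleGraph V) (s : Set V) (v : V) (hv : v ∈ s) :
    (G.induce s).IsSimpleVertex ⟨v, hv⟩ ↔ SimpleIn G s v := by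
  have hCA : ∀ a b : s, CA (G.induce s) a b ↔ CA G a b := by
    intro a b
    simp [CA, Subtype.ext_iff]
  unfold SimpleGraph.IsSimpleVertex SimpleIn
  simp only [Set.subset_def, mem_closedNbhd_iff, hCA]
  simp only [Subtype.forall]

theorem exists_rank {V : Type*} [Fintype V] (G : SimpleGraph V) (hG : G.StronglyChordal) :
    ∀ (n : ℕ) (s : Finset V), s.card = n → ∃ r : V → ℕ, Set.InjOn r s ∧
      ∀ v ∈ s, SimpleIn G {x | x ∈ s ∧ r v ≤ r x} v := by
  classical
  intro n
  induction n with
  | zero =>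
    intro s hs
    rw [Finset.card_eq_zero] at hs
    subst hs
    exact ⟨fun _ => 0, by simp, by simp⟩
  | succ n ih =>
    intro s hs
    have hne : s.Nonempty := Finset.card_pos.1 (by omega)
    haveI : Nonempty (s : Set V) := hne.to_subtype
    obtain ⟨⟨v, hv⟩, hsimp⟩ := exists_simple _ (StronglyChordal_induce G hG (s : Set V))
    rw [simpleIn_iff] at hsimp
    have hv' : v ∈ s := hv
    obtain ⟨r, hr, hrs⟩ := ih (s.erase v) (by rw [Finset.card_erase_of_mem hv']; omega)
    refine ⟨fun x => if x = v then 0 else r x + 1, ?_, ?_⟩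
    · intro x hx y hy hxy
      by_cases c1 : x = v <;> by_cases c2 : y = v
      · rw [c1, c2]
      · simp [c1, c2] at hxy
      · simp [c1, c2] at hxy
      · simp only [c1, c2, if_false, Nat.add_right_cancel_iff] at hxy
        exact hr (by simpa [c1] using hx) (by simpa [c2] using hy) hxy
    · intro x hx
      by_cases c1 : x = v
      · subst c1
        convert hsimp using 1
        ext y; simp
      · convert hrs x (by simp [c1, hx]) using 1
        ext y
        by_cases c2 : y = v <;> simp [c1, c2]

theorem stronglyChordal_of_order {V : Type*} [Fintype V] (G : SimpleGraph V)
    (r : V → ℕ) (hr : Function.Injective r)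
    (h : ∀ v, SimpleIn G {x | r v ≤ r x} v) : G.StronglyChordal := by
  classical
  have key : ∀ n, 4 ≤ n → ∀ f : ZMod n → V, G.IsCycleEmb f → ∃ i,
      CA G (f (i - 1)) (f (i + 1)) ∧
      (CA G (f (i - 1)) (f (i + 2)) ∨ CA G (f (i + 1)) (f (i - 2))) := by
    intro n hn f hf
    haveI : NeZero n := ⟨by omega⟩
    obtain ⟨i, -, hi⟩ := Finset.exists_min_image (Finset.univ : Finset (ZMod n))
      (fun i => r (f i)) Finset.univ_nonempty
    have hmem : ∀ j, f j ∈ {x | r (f i) ≤ r x} := fun j => hi j (Finset.mem_univ j)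
    have a1 : CA G (f i) (f (i + 1)) := Or.inr (hf.2 i)
    have a2 : CA G (f i) (f (i - 1)) := by
      have := hf.2 (i - 1); rw [sub_add_cancel] at this; exact Or.inr this.symm
    have a3 : CA G (f (i + 1)) (f (i + 2)) := by
      have := hf.2 (i + 1); rw [show i + 1 + 1 = i + 2 by ring] at this; exact Or.inr this
    have a4 : CA G (f (i - 1)) (f (i - 2)) := by
      have := hf.2 (i - 2); rw [show i - 2 + 1 = i - 1 by ring] at this; exact Or.inr this.symm
    refine ⟨i, ?_⟩
    rcases h (f i) _ (hmem (i - 1)) _ (hmem (i + 1)) a2 a1 with h1 | h1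
    · exact ⟨(h1 _ (hmem (i - 1)) (CA.refl _ _)).symm, Or.inr (h1 _ (hmem _) a4)⟩
    · exact ⟨h1 _ (hmem (i + 1)) (CA.refl _ _), Or.inl (h1 _ (hmem _) a3)⟩
  have hk : ∀ n : ℕ, ∀ k : ℕ, 0 < k → k < n → (k : ZMod n) ≠ 0 := by
    intro n k hk0 hkn h0
    rw [ZMod.natCast_eq_zero_iff] at h0
    exact absurd (Nat.le_of_dvd hk0 h0) (by omega)
  refine ⟨fun n hn f hf => ?_, fun n hn he f hf => ?_⟩
  · obtain ⟨i, hi, -⟩ := key n hn f hf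
    have k1 := hk n 1 (by omega) (by omega)
    have k2 := hk n 2 (by omega) (by omega)
    have k3 := hk n 3 (by omega) (by omega)
    push_cast at k1 k2 k3
    refine ⟨i - 1, i + 1, hi.resolve_left fun h => ?_, fun h => ?_, fun h => ?_⟩
    · have := hf.1 h
      exact k2 (by linear_combination -this)
    · exact k1 (by linear_combination h)
    · exact k3 (by linear_combination -h)
  · obtain ⟨i, -, hi⟩ := key n (by omega) f hf
    have k2 := hk n 2 (by omega) (by omega)
    have k3 := hk n 3 (by omega) (by omega)
    have k4 := hk n 4 (by omega) (by omega)
    push_cast at k2 k3 k4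
    have v3 : ((3 : ℕ) : ZMod n).val = 3 := ZMod.val_natCast_of_lt (by omega)
    haveI : NeZero n := ⟨by omega⟩
    haveI : NeZero (3 : ZMod n) := ⟨k3⟩
    rcases hi with hi | hi
    · refine ⟨i - 1, i + 2, ⟨hi.resolve_left fun h => ?_, fun h => ?_, fun h => ?_⟩, ?_⟩
      · have := hf.1 h
        exact k3 (by linear_combination -this)
      · exact k2 (by linear_combination h)
      · exact k4 (by linear_combination -h)
      · rw [show i + 2 - (i - 1) = ((3 : ℕ) : ZMod n) by push_cast; ring, v3]
        decide
    · refine ⟨i - 2, i + 1, ⟨(hi.symm).resolve_left fun h => ?_, fun h => ?_, fun h => ?_⟩, ?_⟩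
      · have := hf.1 h
        exact k3 (by linear_combination -this)
      · exact k2 (by linear_combination h)
      · exact k4 (by linear_combination -h)
      · rw [show i + 1 - (i - 2) = ((3 : ℕ) : ZMod n) by push_cast; ring, v3]
        decide

/-- A finite simple graph is strongly chordal iff there is an ordering of its
vertices such that each `σ i` is simple in the subgraph induced by
`{σ i, σ (i+1), …}`. -/
theorem stronglyChordal_iff_simple_elimination {V : Type*} [Fintype V] (G : SimpleGraph V) :
    G.StronglyChordal ↔ ∃ σ : Fin (Fintype.card V) ≃ V,
      ∀ i : Fin (Fintype.card V),
        (G.induce (σ '' {j | i ≤ j})).IsSimpleVertex ⟨σ i, ⟨i, le_refl i, rfl⟩⟩ := by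
  constructor
  · intro hG
    obtain ⟨r, hr, hrs⟩ := exists_rank G hG _ Finset.univ rfl
    have hr' : Function.Injective r := fun x y h => hr (by simp) (by simp) h
    letI : LinearOrder V := LinearOrder.lift' r hr'
    let σ := Fintype.orderIsoFinOfCardEq V rfl
    refine ⟨σ.toEquiv, fun i => ?_⟩
    refine (simpleIn_iff G _ _ _).2 ?_
    suffices hset : (σ.toEquiv '' {j | i ≤ j}) = {x | x ∈ Finset.univ ∧ r (σ i) ≤ r x} by
      rw [hset]
      exact hrs (σ i) (Finset.mem_univ _)
    ext x
    constructor
    · rintro ⟨j, hj, rfl⟩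
      exact ⟨Finset.mem_univ _, (σ.le_iff_le.2 hj : σ i ≤ σ j)⟩
    · rintro ⟨-, hx⟩
      refine ⟨σ.symm x, ?_, σ.apply_symm_apply x⟩
      show i ≤ σ.symm x
      rw [← σ.le_iff_le, σ.apply_symm_apply]
      exact hx
  · rintro ⟨σ, hσ⟩
    refine stronglyChordal_of_order G (fun v => (σ.symm v : ℕ))
      (fun x y h => σ.symm.injective (Fin.ext h)) fun v => ?_
    have := (simpleIn_iff G _ _ _).1 (hσ (σ.symm v))
    suffices hset : {x | (σ.symm v : ℕ) ≤ (σ.symm x : ℕ)} = (σ '' {j | σ.symm v ≤ j}) by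
      rw [σ.apply_symm_apply] at this
      show SimpleIn G {x | (σ.symm v : ℕ) ≤ (σ.symm x : ℕ)} v
      rw [hset]
      exact this
    · ext x
      constructor
      · intro hx
        exact ⟨σ.symm x, hx, by simp⟩
      · rintro ⟨j, hj, rfl⟩
        show (σ.symm v : ℕ) ≤ (σ.symm (σ j) : ℕ)
        rw [Equiv.symm_apply_apply]; exact hj
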